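/- Suppose the standing assumptions hold and there exists a trajectory (x(t), u(t)) for t ∈ [0, ∞) with x(t) ∈ X satisfying the mass-spring-damper dynamics: (d/dt)∇ψ(x(t)) = −L_d(G) x(t) − E_s(G) u(t) − g(t) and (d/dt) u(t) = E_s(G)ᵀ x(t), where g(t) ∈ ∂f(x(t)) for every t. Then for every T > 0, letting x̄(T) = (1/T)∫₀ᵀ x(t) dt, one has ℓ(x̄(T)) − ℓ(x*) + (1/2)⟨L_d(G) x̄(T), x̄(T)⟩ ≤ V(x(0), u(0))/T. -/

import Mathlib

open scoped RealInnerProductSpace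
open Finset

noncomputable section

/-- `ℝ^n` with the Euclidean (l2) structure. -/
abbrev Vec (n : ℕ) := EuclideanSpace ℝ (Fin n)

/-- Entry `(i, e)` of the incidence matrix `E(G)` of an oriented graph:
`+1` if `i` is the head of edge `e`, `-1` if it is the tail, `0` otherwise. -/
def incid {V Ed : Type*} [DecidableEq V] (head tail : Ed → V) (i : V) (e : Ed) : ℝ :=
  if i = head e then 1 else if i = tail e then -1 else 0

/-- Action of `E_w(G) = (E(G) diag(√w)) ⊗ I_n` on an edge-indexed block vector. -/
def esOp {n : ℕ} {V Ed : Type*} [Fintype Ed] [DecidableEq V] (head tail : Ed → V)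
    (w : Ed → ℝ) (u : Ed → Vec n) : V → Vec n :=
  fun i => ∑ e, (incid head tail i e * Real.sqrt (w e)) • u e

/-- Action of `E_w(G)ᵀ = (diag(√w) E(G)ᵀ) ⊗ I_n` on a node-indexed block vector. -/
def esTOp {n : ℕ} {V Ed : Type*} [Fintype V] [DecidableEq V] (head tail : Ed → V)
    (w : Ed → ℝ) (x : V → Vec n) : Ed → Vec n :=
  fun e => ∑ i, (incid head tail i e * Real.sqrt (w e)) • x i

/-- Action of the weighted Laplacian `L_w(G) = (E(G) diag(w) E(G)ᵀ) ⊗ I_n`. -/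
def lapOp {n : ℕ} {V Ed : Type*} [Fintype V] [Fintype Ed] [DecidableEq V] (head tail : Ed → V)
    (w : Ed → ℝ) (x : V → Vec n) : V → Vec n :=
  fun i => ∑ j, (∑ e, incid head tail i e * w e * incid head tail j e) • x j

/-- Euclidean inner product on the node space `ℝ^{|V| n}`. -/
def innV {n : ℕ} {V : Type*} [Fintype V] (x y : V → Vec n) : ℝ := ∑ i, ⟪x i, y i⟫

/-- Euclidean inner product on the edge space `ℝ^{|Ed| n}`. -/
def innE {n : ℕ} {Ed : Type*} [Fintype Ed] (u v : Ed → Vec n) : ℝ := ∑ e, ⟪u e, v e⟫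

/-- The Cartesian product `X = X₀^{|V|}`. -/
def prodSet {n : ℕ} (V : Type*) (X0 : Set (Vec n)) : Set (V → Vec n) := {x | ∀ i, x i ∈ X0}

/-- `f(x) = ∑ᵢ fᵢ(xᵢ)`. -/
def sumF {n : ℕ} {V : Type*} [Fintype V] (f : V → Vec n → ℝ) (x : V → Vec n) : ℝ :=
  ∑ i, f i (x i)

/-- Bregman divergence `B_ψ(x', x)` for `ψ(x) = ∑ᵢ ψ₀(xᵢ)` with `∇ψ₀ = g0`. -/
def Bpsi {n : ℕ} {V : Type*} [Fintype V] (psi0 : Vec n → ℝ) (g0 : Vec n → Vec n)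
    (x' x : V → Vec n) : ℝ :=
  (∑ i, psi0 (x' i)) - (∑ i, psi0 (x i)) - ∑ i, ⟪g0 (x i), x' i - x i⟫

/-- `g ∈ ∂F(x)`: `g` is a subgradient of `F` at `x` (relative to the domain `Xs`). -/
def IsSubgrad {n : ℕ} {V : Type*} [Fintype V] (F : (V → Vec n) → ℝ) (Xs : Set (V → Vec n))
    (x g : V → Vec n) : Prop :=
  ∀ x' ∈ Xs, F x' - F x ≥ innV (x' - x) g

/-- The Lyapunov function `V(x, u) = B_ψ(x*, x) + (1/2)‖u − u*‖₂²`. -/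
def Vlyap {n : ℕ} {V Ed : Type*} [Fintype V] [Fintype Ed] (psi0 : Vec n → ℝ)
    (g0 : Vec n → Vec n) (xstar : V → Vec n) (ustar : Ed → Vec n)
    (x : V → Vec n) (u : Ed → Vec n) : ℝ :=
  Bpsi psi0 g0 xstar x + (1/2) * innE (u - ustar) (u - ustar)

/-- The shifted Lagrangian `ℓ(x) = f(x) + ⟨E_s(G) u*, x⟩`. -/
def ellF {n : ℕ} {V Ed : Type*} [Fintype V] [Fintype Ed] [DecidableEq V]
    (f : V → Vec n → ℝ) (head tail : Ed → V) (sw : Ed → ℝ) (ustar : Ed → Vec n)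
    (x : V → Vec n) : ℝ :=
  sumF f x + innV (esOp head tail sw ustar) x

section Convexity

variable {F : Type*} [NormedAddCommGroup F] [InnerProductSpace ℝ F] [CompleteSpace F]

/-- First-order characterization of convexity, with a gradient relative to the set. -/
lemma ConvexOn.inner_gradient_le_sub {s : Set F} {h : F → ℝ} {v x y : F} (hh : ConvexOn ℝ s h)
    (hy : y ∈ s) (hx : x ∈ s) (hv : HasGradientWithinAt h v s y) : ⟪v, x - y⟫ ≤ h x - h y := by
  have hconv := hh.comp_affineMap (AffineMap.lineMap y x : ℝ →ᵃ[ℝ] F)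
  have hderiv : HasDerivWithinAt (h ∘ (AffineMap.lineMap y x : ℝ →ᵃ[ℝ] F)) ⟪v, x - y⟫
      ((AffineMap.lineMap y x : ℝ →ᵃ[ℝ] F) ⁻¹' s) 0 := by
    have hv' : HasFDerivWithinAt h (InnerProductSpace.toDual ℝ F v) s
        (AffineMap.lineMap y x (0 : ℝ)) := by
      simpa using hv.hasFDerivWithinAt
    simpa using hv'.comp_hasDerivWithinAt (0 : ℝ) AffineMap.hasDerivWithinAt_lineMap
      (Set.mapsTo_preimage _ _)
  have hle := hconv.le_slope_of_hasDerivWithinAt (x := 0) (y := 1) (by simpa using hy)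
    (by simpa using hx) one_pos hderiv
  simpa [slope_def_field] using hle

variable {s : Set F} {p : F → ℝ} {γ : F → F}

/-- First-order characterization of `1`-strong convexity. -/
lemma inner_add_half_norm_sq_le_sub (hgrad : ∀ y ∈ s, HasGradientWithinAt p (γ y) s y)
    (hSC : ConvexOn ℝ s fun y => p y - (1 / 2) * ‖y‖ ^ 2) {x y : F} (hx : x ∈ s) (hy : y ∈ s) :
    ⟪γ y, x - y⟫ + (1 / 2) * ‖x - y‖ ^ 2 ≤ p x - p y := by
  have hg : HasGradientWithinAt (fun y => p y - (1 / 2) * ‖y‖ ^ 2) (γ y - y) s y := by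
    rw [hasGradientWithinAt_iff_hasFDerivWithinAt]
    have h2 := ((hasStrictFDerivAt_norm_sq y).hasFDerivAt.hasFDerivWithinAt (s := s)).const_mul
      (1 / 2 : ℝ)
    refine ((hgrad y hy).hasFDerivWithinAt.sub h2).congr_fderiv ?_
    ext z
    simp
  have h1 := hSC.inner_gradient_le_sub hy hx hg
  have h2 : ‖x - y‖ ^ 2 = ‖x‖ ^ 2 - 2 * ⟪x, y⟫ + ‖y‖ ^ 2 := norm_sub_sq_real x y
  simp only [inner_sub_left, inner_sub_right, real_inner_self_eq_norm_sq,
    real_inner_comm x y] at h1 ⊢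
  have h3 : ⟪x, y⟫ = ⟪y, x⟫ := real_inner_comm _ _
  linarith

/-- The inverse of the gradient of a `1`-strongly convex function is nonexpansive. -/
lemma norm_sub_le_norm_gradient_sub (hgrad : ∀ y ∈ s, HasGradientWithinAt p (γ y) s y)
    (hSC : ConvexOn ℝ s fun y => p y - (1 / 2) * ‖y‖ ^ 2) {x y : F} (hx : x ∈ s) (hy : y ∈ s) :
    ‖x - y‖ ≤ ‖γ x - γ y‖ := by
  have h1 := inner_add_half_norm_sq_le_sub hgrad hSC hx hy
  have h2 := inner_add_half_norm_sq_le_sub hgrad hSC hy hx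
  have h3 := real_inner_le_norm (γ x - γ y) (x - y)
  rw [norm_sub_rev y x] at h2
  rw [← neg_sub x y, inner_neg_right] at h2
  rw [inner_sub_left] at h3
  by_contra! hlt
  nlinarith [norm_nonneg (x - y), norm_nonneg (γ x - γ y)]

/-- Along a curve on which the mirror image `γ (y ·)` is differentiable, the Bregman divergence
to a fixed point is differentiable, even if the curve `y` itself is not. -/
lemma hasDerivWithinAt_bregman (hgrad : ∀ y ∈ s, HasGradientWithinAt p (γ y) s y)
    (hSC : ConvexOn ℝ s fun y => p y - (1 / 2) * ‖y‖ ^ 2) {I : Set ℝ} {y : ℝ → F} {z : F} {t : ℝ}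
    (c : F) (ht : t ∈ I) (hyI : ∀ τ ∈ I, y τ ∈ s)
    (hz : HasDerivWithinAt (fun τ => γ (y τ)) z I t) :
    HasDerivWithinAt (fun τ => p c - p (y τ) - ⟪γ (y τ), c - y τ⟫) ⟪z, y t - c⟫ I t := by
  have hrem : HasDerivWithinAt
      (fun τ => p (y t) - p (y τ) - ⟪γ (y τ), y t - y τ⟫) 0 I t := by
    have hsmall : (fun τ => p (y t) - p (y τ) - ⟪γ (y τ), y t - y τ⟫)
        =O[nhdsWithin t I] fun τ => ‖τ - t‖ ^ 2 := by
      refine Asymptotics.IsBigO.trans ?_ (hz.hasFDerivWithinAt.isBigO_sub.norm_left.norm_right.pow 2)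
      refine Asymptotics.IsBigO.of_bound 1 ?_
      filter_upwards [self_mem_nhdsWithin] with τ hτ
      have h1 := inner_add_half_norm_sq_le_sub hgrad hSC (hyI τ hτ) (hyI t ht)
      have h2 := inner_add_half_norm_sq_le_sub hgrad hSC (hyI t ht) (hyI τ hτ)
      have h3 := norm_sub_le_norm_gradient_sub hgrad hSC (hyI τ hτ) (hyI t ht)
      have h4 := real_inner_le_norm (γ (y τ) - γ (y t)) (y τ - y t)
      have h5 : ⟪γ (y τ), y t - y τ⟫ = -⟪γ (y τ), y τ - y t⟫ := by
        rw [← neg_sub (y τ) (y t), inner_neg_right]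
      rw [inner_sub_left] at h4
      rw [Real.norm_eq_abs, abs_of_nonneg (by nlinarith [norm_nonneg (y t - y τ)]), one_mul,
        Real.norm_of_nonneg (by positivity)]
      nlinarith [norm_nonneg (y τ - y t), norm_nonneg (γ (y τ) - γ (y t))]
    rw [hasDerivWithinAt_iff_isLittleO]
    simpa using hsmall.trans_isLittleO ((Asymptotics.isLittleO_pow_sub_sub t one_lt_two).mono
      nhdsWithin_le_nhds)
  have hlin := (hz.inner ℝ (hasDerivWithinAt_const t I (y t - c))).add hrem
  simp only [inner_zero_right, zero_add, add_zero] at hlin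
  refine (hlin.const_add (p c - p (y t))).congr_of_mem (fun τ _ => ?_) ht
  simp only [Pi.add_apply, inner_sub_right]
  ring

end Convexity

section BlockVectors

lemma esTOp_sub {n : ℕ} {V Ed : Type*} [Fintype V] [DecidableEq V] (head tail : Ed → V)
    (w : Ed → ℝ) (y z : V → Vec n) :
    esTOp head tail w (y - z) = esTOp head tail w y - esTOp head tail w z := by
  ext1 e
  simp [esTOp, smul_sub, Finset.sum_sub_distrib]

/-- The consensus constraint `E_w(G)ᵀ y = 0` does not depend on the positive weights. -/
lemma esTOp_eq_zero_of_weights {n : ℕ} {V Ed : Type*} [Fintype V] [DecidableEq V]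
    (head tail : Ed → V) {w w' : Ed → ℝ} (hw : ∀ e, 0 < w e) {y : V → Vec n}
    (h : esTOp head tail w y = 0) : esTOp head tail w' y = 0 := by
  ext1 e
  have he := congrFun h e
  simp only [esTOp, Pi.zero_apply, mul_comm (incid head tail _ _), mul_smul,
    ← Finset.smul_sum] at he ⊢
  rw [(smul_eq_zero.1 he).resolve_left (Real.sqrt_pos.2 (hw e)).ne', smul_zero]

variable {n : ℕ} {V Ed : Type*} [Fintype V] [Fintype Ed]

/-- `innV c` as a continuous linear functional. -/
def innVL (c : V → Vec n) : (V → Vec n) →L[ℝ] ℝ :=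
  ∑ i, (innerSL ℝ (c i)).comp (ContinuousLinearMap.proj i)

lemma innVL_apply (c y : V → Vec n) : innVL c y = innV c y := by
  simp [innVL, innV]

lemma innV_comm (x y : V → Vec n) : innV x y = innV y x := by
  simp [innV, real_inner_comm]

lemma innE_self_nonneg (v : Ed → Vec n) : 0 ≤ innE v v :=
  Finset.sum_nonneg fun _ _ => real_inner_self_nonneg

lemma two_mul_innE_sub_le (v w : Ed → Vec n) : 2 * innE v w - innE v v ≤ innE w w := by
  have h := innE_self_nonneg (w - v)
  simp only [innE, Pi.sub_apply, inner_sub_left, inner_sub_right, Finset.sum_sub_distrib] at h ⊢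
  have hc : ∑ e, ⟪w e, v e⟫ = ∑ e, ⟪v e, w e⟫ := by simp [real_inner_comm]
  linarith

variable [DecidableEq V] (head tail : Ed → V)

lemma innV_esOp (w : Ed → ℝ) (v : Ed → Vec n) (y : V → Vec n) :
    innV (esOp head tail w v) y = innE v (esTOp head tail w y) := by
  simp only [innV, innE, esOp, esTOp, sum_inner, inner_sum, real_inner_smul_left,
    real_inner_smul_right]
  exact Finset.sum_comm

lemma lapOp_eq_esOp_esTOp {w : Ed → ℝ} (hw : ∀ e, 0 < w e) (y : V → Vec n) :
    lapOp head tail w y = esOp head tail w (esTOp head tail w y) := by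
  ext1 i
  simp only [lapOp, esOp, esTOp, Finset.smul_sum, Finset.sum_smul, smul_smul]
  rw [Finset.sum_comm]
  refine Finset.sum_congr rfl fun e _ => Finset.sum_congr rfl fun j _ => ?_
  congr 1
  linear_combination (-(incid head tail i e * incid head tail j e)) *
    Real.mul_self_sqrt (hw e).le

lemma innV_lapOp {w : Ed → ℝ} (hw : ∀ e, 0 < w e) (y z : V → Vec n) :
    innV (lapOp head tail w y) z = innE (esTOp head tail w y) (esTOp head tail w z) := by
  rw [lapOp_eq_esOp_esTOp head tail hw, innV_esOp]

end BlockVectors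

section Trajectories

lemma prodSet_eq_pi {n : ℕ} {V : Type*} (X0 : Set (Vec n)) : prodSet V X0 = Set.univ.pi fun _ => X0 := by
  ext; simp [prodSet]

variable {n : ℕ} {V : Type*} [Fintype V]

lemma Bpsi_eq_sum (psi0 : Vec n → ℝ) (g0 : Vec n → Vec n) (x' x : V → Vec n) :
    Bpsi psi0 g0 x' x = ∑ i, (psi0 (x' i) - psi0 (x i) - ⟪g0 (x i), x' i - x i⟫) := by
  simp [Bpsi, Finset.sum_sub_distrib]

/-- A closed convex separable function has affine minorants on the product set that are almost
tight at a given point. -/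
lemma exists_affine_le_sumF {X0 : Set (Vec n)} (hclosed : IsClosed X0) {f : V → Vec n → ℝ}
    (hconv : ∀ i, ConvexOn ℝ X0 (f i)) (hlsc : ∀ i, LowerSemicontinuousOn (f i) X0)
    {y : V → Vec n} (hy : y ∈ prodSet V X0) {ε : ℝ} (hε : 0 < ε) :
    ∃ (Λ : (V → Vec n) →L[ℝ] ℝ) (c : ℝ),
      (∀ z ∈ prodSet V X0, Λ z + c ≤ sumF f z) ∧ Λ y + c = sumF f y - Fintype.card V * ε := by
  choose l c hle heq using fun i => (hconv i).exists_affine_le_of_lt (𝕜 := ℝ) (hy i)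
    (sub_lt_self (f i (y i)) hε) hclosed (hlsc i)
  refine ⟨∑ i, (l i).comp (ContinuousLinearMap.proj i), ∑ i, c i, fun z hz => ?_, ?_⟩
  · simp only [_root_.sum_apply, ← Finset.sum_add_distrib, sumF]
    exact Finset.sum_le_sum fun i _ => by simpa using hle i ⟨z i, hz i⟩
  · simp only [_root_.sum_apply, ← Finset.sum_add_distrib, sumF]
    rw [Finset.sum_congr rfl fun i _ => by simpa using heq i]
    simp

/-- Time averages of continuous curves in `X₀^{|V|}` stay in `X₀^{|V|}`. -/
lemma average_mem_prodSet {X0 : Set (Vec n)} (hclosed : IsClosed X0) (hconvex : Convex ℝ X0)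
    {x : ℝ → V → Vec n} {T : ℝ} (hT : 0 < T) (hx : ∀ t ∈ Set.Icc 0 T, x t ∈ prodSet V X0)
    (hcont : ContinuousOn x (Set.Icc 0 T)) :
    (1 / T) • ∫ τ in (0 : ℝ)..T, x τ ∈ prodSet V X0 := by
  have h := interval_average_eq x 0 T
  rw [sub_zero, ← one_div] at h
  rw [← h, prodSet_eq_pi, Set.uIoc_of_le hT.le]
  rw [prodSet_eq_pi] at hx
  refine (convex_pi fun _ _ => hconvex).set_average_mem (isClosed_set_pi fun _ _ => hclosed)
    (by simp [hT]) (by simp) ?_ (hcont.integrableOn_Icc.mono_set Set.Ioc_subset_Icc_self)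
  filter_upwards [MeasureTheory.ae_restrict_mem measurableSet_Ioc] with t ht
  exact hx t (Set.Ioc_subset_Icc_self ht)

/-- A curve whose mirror image is continuous is continuous. -/
lemma continuousOn_of_continuousOn_gradient {X0 : Set (Vec n)} {psi0 : Vec n → ℝ}
    {g0 : Vec n → Vec n} (hgrad : ∀ y ∈ X0, HasGradientWithinAt psi0 (g0 y) X0 y)
    (hSC : ConvexOn ℝ X0 fun y => psi0 y - (1 / 2) * ‖y‖ ^ 2) {x : ℝ → V → Vec n} {I : Set ℝ}
    (hx : ∀ t ∈ I, x t ∈ prodSet V X0) (hcont : ContinuousOn (fun τ i => g0 (x τ i)) I) :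
    ContinuousOn x I := by
  intro t ht
  refine tendsto_iff_dist_tendsto_zero.2 <| squeeze_zero' (.of_forall fun _ => dist_nonneg) ?_
    (tendsto_iff_dist_tendsto_zero.1 (hcont t ht))
  filter_upwards [self_mem_nhdsWithin] with τ hτ
  refine (dist_pi_le_iff dist_nonneg).2 fun i => le_trans ?_ (dist_le_pi_dist _ _ i)
  simpa only [dist_eq_norm] using
    norm_sub_le_norm_gradient_sub hgrad hSC (hx τ hτ i) (hx t ht i)

/-- The Lyapunov function is differentiable along any curve whose mirror image is. -/
lemma hasDerivWithinAt_Vlyap {Ed : Type*} [Fintype Ed] {X0 : Set (Vec n)} {psi0 : Vec n → ℝ}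
    {g0 : Vec n → Vec n} (hgrad : ∀ y ∈ X0, HasGradientWithinAt psi0 (g0 y) X0 y)
    (hSC : ConvexOn ℝ X0 fun y => psi0 y - (1 / 2) * ‖y‖ ^ 2) (xstar : V → Vec n)
    (ustar : Ed → Vec n) {x : ℝ → V → Vec n} {u : ℝ → Ed → Vec n} {I : Set ℝ} {t : ℝ}
    {z : V → Vec n} {v : Ed → Vec n} (ht : t ∈ I) (hx : ∀ τ ∈ I, x τ ∈ prodSet V X0)
    (hz : HasDerivWithinAt (fun τ i => g0 (x τ i)) z I t) (hv : HasDerivWithinAt u v I t) :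
    HasDerivWithinAt (fun τ => Vlyap psi0 g0 xstar ustar (x τ) (u τ))
      (innV z (x t - xstar) + innE v (u t - ustar)) I t := by
  have hB : HasDerivWithinAt (fun τ => Bpsi psi0 g0 xstar (x τ)) (innV z (x t - xstar)) I t := by
    simp only [Bpsi_eq_sum, innV, Pi.sub_apply]
    exact HasDerivWithinAt.fun_sum fun i _ => hasDerivWithinAt_bregman hgrad hSC (xstar i) ht
      (fun τ hτ => hx τ hτ i) (hasDerivWithinAt_pi.1 hz i)
  have hU : HasDerivWithinAt (fun τ => (1 / 2) * innE (u τ - ustar) (u τ - ustar))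
      (innE v (u t - ustar)) I t := by
    have h : ∀ e, HasDerivWithinAt (fun τ => (u τ - ustar) e) (v e) I t := fun e =>
      (hasDerivWithinAt_pi.1 hv e).sub_const (ustar e)
    refine ((HasDerivWithinAt.fun_sum fun e (_ : e ∈ Finset.univ) =>
      (h e).inner ℝ (h e)).const_mul (1 / 2 : ℝ)).congr_deriv ?_
    simp only [real_inner_comm, Finset.sum_add_distrib, innE]
    ring
  exact hB.add hU

lemma Vlyap_nonneg {Ed : Type*} [Fintype Ed] {X0 : Set (Vec n)} {psi0 : Vec n → ℝ}
    {g0 : Vec n → Vec n} (hgrad : ∀ y ∈ X0, HasGradientWithinAt psi0 (g0 y) X0 y)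
    (hSC : ConvexOn ℝ X0 fun y => psi0 y - (1 / 2) * ‖y‖ ^ 2) {x xstar : V → Vec n}
    (ustar u : Ed → Vec n) (hxstar : xstar ∈ prodSet V X0) (hx : x ∈ prodSet V X0) :
    0 ≤ Vlyap psi0 g0 xstar ustar x u := by
  have hB : 0 ≤ Bpsi psi0 g0 xstar x := by
    rw [Bpsi_eq_sum]
    refine Finset.sum_nonneg fun i _ => ?_
    nlinarith [inner_add_half_norm_sq_le_sub hgrad hSC (hxstar i) (hx i)]
  have hU := innE_self_nonneg (u - ustar)
  rw [Vlyap]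
  linarith

/-- Along the mass-spring-damper dynamics, the Lyapunov function decreases at least as fast as
the Lagrangian gap plus the disagreement. -/
lemma lyapunov_decrease {Ed : Type*} [Fintype Ed] [DecidableEq V] (head tail : Ed → V)
    {sw dw : Ed → ℝ} (hsw : ∀ e, 0 < sw e) (hdw : ∀ e, 0 < dw e) {X : Set (V → Vec n)}
    {F : (V → Vec n) → ℝ} {x xstar g : V → Vec n} {u ustar : Ed → Vec n}
    (hxstar : xstar ∈ X) (hprimal : esTOp head tail sw xstar = 0) (hg : IsSubgrad F X x g) :
    innV (-(lapOp head tail dw x) - esOp head tail sw u - g) (x - xstar)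
        + innE (esTOp head tail sw x) (u - ustar)
      ≤ F xstar - F x - innV (esOp head tail sw ustar) x
        - innE (esTOp head tail dw x) (esTOp head tail dw x) := by
  have hd : esTOp head tail dw xstar = 0 := esTOp_eq_zero_of_weights head tail hsw hprimal
  have h1 : innV (lapOp head tail dw x) (x - xstar)
      = innE (esTOp head tail dw x) (esTOp head tail dw x) := by
    rw [innV_lapOp head tail hdw, esTOp_sub, hd, sub_zero]
  have h2 : innV (esOp head tail sw u) (x - xstar) = innE u (esTOp head tail sw x) := by
    rw [innV_esOp, esTOp_sub, hprimal, sub_zero]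
  have h3 : innE (esTOp head tail sw x) (u - ustar)
      = innE u (esTOp head tail sw x) - innV (esOp head tail sw ustar) x := by
    rw [innV_esOp]
    simp [innE, inner_sub_right, Finset.sum_sub_distrib, real_inner_comm]
  have h4 : innV (-(lapOp head tail dw x) - esOp head tail sw u - g) (x - xstar)
      = -innV (lapOp head tail dw x) (x - xstar) - innV (esOp head tail sw u) (x - xstar)
        + innV (xstar - x) g := by
    rw [innV_comm (xstar - x) g, ← neg_sub x xstar]
    simp only [innV, Pi.sub_apply, Pi.neg_apply, inner_sub_left, inner_neg_left, inner_neg_right,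
      Finset.sum_sub_distrib, Finset.sum_neg_distrib]
    ring
  have h5 := hg xstar hxstar
  linarith

end Trajectories

/-- **Continuous-time convergence of the mass-spring-damper dynamics (Lemma 1).**
Under the standing assumptions, suppose `(x(t), u(t))`, `t ∈ [0, ∞)`, is a trajectory with
`x(t) ∈ X` of the dynamics `(d/dt)∇ψ(x(t)) = −L_d(G)x(t) − E_s(G)u(t) − g(t)`,
`(d/dt)u(t) = E_s(G)ᵀ x(t)`, where `g(t) ∈ ∂f(x(t))` for every `t`.  Then for every
`T > 0`, with `x̄(T) = (1/T)∫₀ᵀ x(t) dt`,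
`ℓ(x̄(T)) − ℓ(x*) + (1/2)⟨L_d(G)x̄(T), x̄(T)⟩ ≤ V(x(0), u(0))/T`. -/
theorem msd_continuous_time_bound
    {n : ℕ} {V Ed : Type*} [Fintype V] [Fintype Ed] [DecidableEq V]
    -- the graph: a fixed orientation of a finite, undirected, connected graph
    (head tail : Ed → V)
    (hLoop : ∀ e, head e ≠ tail e)
    (hSimple : Function.Injective fun e => Sym2.mk (head e, tail e))
    (hConn : (SimpleGraph.fromRel fun i j => ∃ e, head e = i ∧ tail e = j).Connected)
    -- strictly positive edge weights s and d
    (sw dw : Ed → ℝ) (hsw : ∀ e, 0 < sw e) (hdw : ∀ e, 0 < dw e)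
    -- the local constraint set X₀ and the distance generating function ψ₀
    (X0 : Set (Vec n)) (hX0closed : IsClosed X0) (hX0convex : Convex ℝ X0)
    (psi0 : Vec n → ℝ) (g0 : Vec n → Vec n)
    (hpsi0grad : ∀ y ∈ X0, HasGradientWithinAt psi0 (g0 y) X0 y)
    (hpsi0C1 : ContinuousOn g0 X0)
    (hpsi0SC : ConvexOn ℝ X0 (fun y => psi0 y - (1/2) * ‖y‖^2))
    -- proper closed convex local costs fᵢ
    (f : V → Vec n → ℝ)
    (hfconv : ∀ i, ConvexOn ℝ X0 (f i))
    (hflsc : ∀ i, LowerSemicontinuousOn (f i) X0)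
    -- a primal-dual (saddle) point (x*, u*) with g* ∈ ∂f(x*)
    (xstar : V → Vec n) (ustar : Ed → Vec n) (gstar : V → Vec n)
    (hxstarMem : xstar ∈ prodSet V X0)
    (hgstar : IsSubgrad (sumF f) (prodSet V X0) xstar gstar)
    (hprimal : esTOp head tail sw xstar = 0)
    (hdual : ∀ x' ∈ prodSet V X0, innV (-gstar - esOp head tail sw ustar) (x' - xstar) ≤ 0)
    -- the trajectory of the mass-spring-damper dynamics on [0, ∞)
    (x : ℝ → V → Vec n) (u : ℝ → Ed → Vec n) (g : ℝ → V → Vec n)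
    (hxMem : ∀ t ∈ Set.Ici (0:ℝ), x t ∈ prodSet V X0)
    (hg : ∀ t ∈ Set.Ici (0:ℝ), IsSubgrad (sumF f) (prodSet V X0) (x t) (g t))
    (hdyn1 : ∀ t ∈ Set.Ici (0:ℝ),
      HasDerivWithinAt (fun τ => (fun i => g0 (x τ i)))
        (-(lapOp head tail dw (x t)) - esOp head tail sw (u t) - g t) (Set.Ici 0) t)
    (hdyn2 : ∀ t ∈ Set.Ici (0:ℝ),
      HasDerivWithinAt u (esTOp head tail sw (x t)) (Set.Ici 0) t)
    (T : ℝ) (hT : 0 < T)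
    (xbar : V → Vec n) (hxbar : xbar = (1/T) • ∫ τ in (0:ℝ)..T, x τ) :
    ellF f head tail sw ustar xbar - ellF f head tail sw ustar xstar
        + (1/2) * innV (lapOp head tail dw xbar) xbar
      ≤ Vlyap psi0 g0 xstar ustar (x 0) (u 0) / T := by
  have hxcont : ContinuousOn x (Set.Ici 0) :=
    continuousOn_of_continuousOn_gradient hpsi0grad hpsi0SC hxMem
      fun t ht => (hdyn1 t ht).continuousWithinAt
  have hIcc : Set.Icc 0 T ⊆ Set.Ici (0 : ℝ) := Set.Icc_subset_Ici_self
  have hxint : IntervalIntegrable x MeasureTheory.volume 0 T :=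
    (hxcont.mono hIcc).intervalIntegrable_of_Icc hT.le
  have hxbarMem : xbar ∈ prodSet V X0 := hxbar ▸ average_mem_prodSet hX0closed hX0convex hT
    (fun t ht => hxMem t (hIcc ht)) (hxcont.mono hIcc)
  have hint : ∫ τ in (0 : ℝ)..T, x τ = T • xbar := by
    rw [hxbar, smul_smul, mul_one_div_cancel hT.ne', one_smul]
  have hV : ∀ t ∈ Set.Ici (0 : ℝ), HasDerivWithinAt _ _ (Set.Ici 0) t := fun t ht =>
    hasDerivWithinAt_Vlyap hpsi0grad hpsi0SC xstar ustar ht hxMem (hdyn1 t ht) (hdyn2 t ht)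
  set q : ℝ := innE (esTOp head tail dw xbar) (esTOp head tail dw xbar) with hq
  have hq0 : 0 ≤ q := innE_self_nonneg _
  have hbound : ∀ ε : ℝ, 0 < ε →
      sumF f xbar + innV (esOp head tail sw ustar) xbar - sumF f xstar + q
        ≤ Vlyap psi0 g0 xstar ustar (x 0) (u 0) / T + Fintype.card V * ε := by
    intro ε hε
    obtain ⟨Λ, c, hle, heq⟩ := exists_affine_le_sumF hX0closed hfconv hflsc hxbarMem hε
    set M : (V → Vec n) →L[ℝ] ℝ :=
      Λ + innVL (esOp head tail sw ustar) + (2 : ℝ) • innVL (lapOp head tail dw xbar) with hM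
    have hMapply : ∀ y, M y = Λ y + innV (esOp head tail sw ustar) y
        + 2 * innE (esTOp head tail dw xbar) (esTOp head tail dw y) := fun y => by
      simp [hM, innVL_apply, innV_lapOp head tail hdw]
    set C : ℝ := c - sumF f xstar - q with hC
    have hMx : IntervalIntegrable (fun τ => M (x τ)) MeasureTheory.volume 0 T :=
      (M.continuous.comp_continuousOn (hxcont.mono hIcc)).intervalIntegrable_of_Icc hT.le
    have hMint : IntervalIntegrable (fun τ => -(M (x τ) + C)) MeasureTheory.volume 0 T :=
      (hMx.add intervalIntegrable_const).neg
    have hdecr := intervalIntegral.sub_le_integral_of_hasDeriv_right_of_le hT.le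
      (fun t ht => ((hV t (hIcc ht)).continuousWithinAt.mono hIcc))
      (fun t ht => (hV t ht.1.le).mono fun τ hτ => (ht.1.trans hτ).le)
      ((intervalIntegrable_iff_integrableOn_Icc_of_le hT.le).1 hMint)
      fun t ht => by
        have hmem := hxMem t ht.1.le
        have h1 := lyapunov_decrease head tail hsw hdw (u := u t) (ustar := ustar) hxstarMem
          hprimal (hg t ht.1.le)
        have h2 := hle (x t) hmem
        have h3 := two_mul_innE_sub_le (esTOp head tail dw xbar) (esTOp head tail dw (x t))
        refine h1.trans ?_
        rw [hMapply]
        linarith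
    have hI : ∫ τ in (0 : ℝ)..T, -(M (x τ) + C) = -(T * (M xbar + C)) := by
      rw [intervalIntegral.integral_neg, intervalIntegral.integral_add hMx
        intervalIntegrable_const, M.intervalIntegral_comp_comm hxint, hint, map_smul]
      simp
      ring
    rw [hI] at hdecr
    have hVT := Vlyap_nonneg hpsi0grad hpsi0SC ustar (u T) hxstarMem (hxMem T hT.le)
    have hmul : M xbar + C ≤ Vlyap psi0 g0 xstar ustar (x 0) (u 0) / T := by
      rw [le_div_iff₀ hT]
      linarith
    rw [hMapply] at hmul
    linarith
  have hlim : sumF f xbar + innV (esOp head tail sw ustar) xbar - sumF f xstar + q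
      ≤ Vlyap psi0 g0 xstar ustar (x 0) (u 0) / T := by
    refine le_of_forall_pos_le_add fun δ hδ => ?_
    have hcard : (0 : ℝ) < Fintype.card V + 1 := by positivity
    refine (hbound (δ / (Fintype.card V + 1)) (by positivity)).trans ?_
    gcongr
    rw [mul_div_assoc', div_le_iff₀ hcard]
    nlinarith
  have hstar : innV (esOp head tail sw ustar) xstar = 0 := by
    rw [innV_esOp, hprimal]
    simp [innE]
  rw [ellF, ellF, hstar, innV_lapOp head tail hdw, ← hq]
  linarith
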